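/- Let V : ℝ^d → ℝ satisfy Assumptions 1–3. Then the set X of all local maxima of V is finite, and each local maximum is a strict local maximum with negative definite Hessian. -/

import Mathlib

open MeasureTheory Real Filter Metric Set
open scoped RealInnerProductSpace ENNReal Topology

noncomputable section

abbrev Euc (n : ℕ) := EuclideanSpace ℝ (Fin n)

variable {d : ℕ}

def localMinSet (V : Euc d → ℝ) : Set (Euc d) := {x | IsLocalMin V x}

def localMaxSet (V : Euc d → ℝ) : Set (Euc d) := {x | IsLocalMax V x}

def hessQ (V : Euc d → ℝ) (x v : Euc d) : ℝ := ⟪fderiv ℝ (gradient V) x v, v⟫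

def lap (V : Euc d → ℝ) (x : Euc d) : ℝ :=
  ∑ i, hessQ V x (EuclideanSpace.basisFun (Fin d) ℝ i)

def PoincareIneq {d : ℕ} (μ : Measure (Euc d)) (ρ : ℝ) : Prop :=
  ∀ f : Euc d → ℝ, ContDiff ℝ 1 f →
    Integrable (fun x => (f x) ^ 2) μ →
    Integrable (fun x => ‖gradient f x‖ ^ 2) μ →
    ∫ x, (f x - ∫ y, f y ∂μ) ^ 2 ∂μ ≤ (1 / ρ) * ∫ x, ‖gradient f x‖ ^ 2 ∂μ

def gibbs (V : Euc d → ℝ) (ε : ℝ) : Measure (Euc d) :=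
  (ENNReal.ofReal (∫ x, exp (-V x / ε)))⁻¹ •
    volume.withDensity fun x => ENNReal.ofReal (exp (-V x / ε))

def gibbsOn (V : Euc d → ℝ) (ε : ℝ) (U : Set (Euc d)) : Measure (Euc d) :=
  (ENNReal.ofReal (∫ x in U, exp (-V x / ε)))⁻¹ •
    (volume.restrict U).withDensity fun x => ENNReal.ofReal (exp (-V x / ε))

def uniformOn {d : ℕ} (U : Set (Euc d)) : Measure (Euc d) :=
  (volume U)⁻¹ • volume.restrict U

def Assumption1 (V : Euc d → ℝ) (ν : ℝ) (𝒩 : Set (Euc d) → Set (Euc d)) : Prop :=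
  0 < ν ∧ ∀ x ∈ localMinSet V,
    IsOpen (𝒩 (connectedComponentIn (localMinSet V) x)) ∧
    connectedComponentIn (localMinSet V) x ⊆ 𝒩 (connectedComponentIn (localMinSet V) x) ∧
    ContDiffOn ℝ 3 V (𝒩 (connectedComponentIn (localMinSet V) x)) ∧
    ∀ y ∈ 𝒩 (connectedComponentIn (localMinSet V) x),
      ν * (V y - sInf (V '' 𝒩 (connectedComponentIn (localMinSet V) x))) ≤ ‖gradient V y‖ ^ 2

def NSet (V : Euc d → ℝ) (𝒩 : Set (Euc d) → Set (Euc d)) : Set (Euc d) :=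
  ⋃ x ∈ localMinSet V, 𝒩 (connectedComponentIn (localMinSet V) x)

def Assumption2 (V : Euc d → ℝ) (𝒩 : Set (Euc d) → Set (Euc d)) : Prop :=
  ∀ x ∉ NSet V 𝒩, gradient V x = 0 → ∀ v : Euc d, v ≠ 0 → hessQ V x v < 0

def Assumption3 (V : Euc d → ℝ) (R₀ ν_eb C_g : ℝ) : Prop :=
  0 < R₀ ∧ 0 < ν_eb ∧ 0 < C_g ∧
  (∀ x : Euc d, R₀ ≤ ‖x‖ →
      ν_eb * infDist x (localMinSet V) ≤ ‖gradient V x‖ ∧ |lap V x| ≤ C_g * ‖x‖ ^ 2) ∧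
  Tendsto V (cocompact (Euc d)) atTop ∧
  localMinSet V ⊆ closedBall 0 R₀

theorem aux_grad {d : ℕ} {V : Euc d → ℝ} (hV : ContDiff ℝ 2 V) : ContDiff ℝ 1 (gradient V) := by
  have h : ContDiff ℝ 1 (fderiv ℝ V) := hV.fderiv_right (by norm_num)
  exact (InnerProductSpace.toDual ℝ (Euc d)).symm.toContinuousLinearEquiv.contDiff.comp h

theorem aux_crit {d : ℕ} {V : Euc d → ℝ} {x : Euc d} (h : IsLocalExtr V x) : gradient V x = 0 := by
  simp [gradient, h.fderiv_eq_zero]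

theorem aux_flat {d : ℕ} {V : Euc d → ℝ} (hV : ContDiff ℝ 2 V) {ν : ℝ} (hν : 0 < ν) {y : Euc d}
    (hH : fderiv ℝ (gradient V) y = 0) (hg : gradient V y = 0)
    (hmin : ∀ᶠ x in 𝓝 y, V y ≤ V x)
    (hPL : ∀ᶠ x in 𝓝 y, ν * (V x - V y) ≤ ‖gradient V x‖ ^ 2) :
    ∀ᶠ x in 𝓝 y, V x = V y := by
  have hs : HasStrictFDerivAt (gradient V) (0 : Euc d →L[ℝ] Euc d) y := by
    rw [← hH]
    exact (aux_grad hV).contDiffAt.hasStrictFDerivAt (by norm_num)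
  have hν8 : 0 < ν / 8 := by positivity
  obtain ⟨s, hs1, hs2⟩ := hs.exists_lipschitzOnWith_of_nnnorm_lt (Real.toNNReal (ν / 8))
    (by simpa using hν)
  obtain ⟨r, hr, hball⟩ := Metric.mem_nhds_iff.1 (inter_mem hs1 (inter_mem hmin hPL))
  have hlip : ∀ a ∈ ball y r, ∀ b ∈ ball y r,
      ‖gradient V a - gradient V b‖ ≤ ν / 8 * ‖a - b‖ := by
    intro a ha b hb
    have := hs2.dist_le_mul a (hball ha).1 b (hball hb).1
    rwa [Real.coe_toNNReal _ hν8.le, dist_eq_norm, dist_eq_norm] at this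
  filter_upwards [Metric.ball_mem_nhds y (half_pos hr)] with x hx
  have hx' : ‖x - y‖ < r / 2 := by simpa [dist_eq_norm] using hx
  have hxr : x ∈ ball y r := Metric.ball_subset_ball (by linarith) hx
  have hyr : y ∈ ball y r := Metric.mem_ball_self hr
  set g := gradient V x with hgdef
  have hgx : ‖g‖ ≤ ν / 8 * ‖x - y‖ := by simpa [hg] using hlip x hxr y hyr
  set z := x - (4 / ν) • g with hz
  have hzx : ‖z - x‖ = 4 / ν * ‖g‖ := by
    have : z - x = -((4 / ν) • g) := by rw [hz]; abel
    rw [this, norm_neg, norm_smul, Real.norm_of_nonneg (by positivity)]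
  have hzx2 : ‖z - x‖ ≤ 1 / 2 * ‖x - y‖ := by
    rw [hzx]
    calc 4 / ν * ‖g‖ ≤ 4 / ν * (ν / 8 * ‖x - y‖) := by gcongr
      _ = 1 / 2 * ‖x - y‖ := by field_simp; ring
  have hzr : z ∈ ball y r := by
    rw [mem_ball, dist_eq_norm]
    have : ‖z - y‖ ≤ ‖z - x‖ + ‖x - y‖ := norm_sub_le_norm_sub_add_norm_sub z x y
    linarith
  have hder : ∀ w, HasFDerivAt V (InnerProductSpace.toDual ℝ (Euc d) (gradient V w)) w :=
    fun w => ((hV.differentiable (by norm_num)) w).hasGradientAt.hasFDerivAt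
  have hseg : segment ℝ x z ⊆ ball y r := (convex_ball y r).segment_subset hxr hzr
  have hmv := (convex_segment x z).norm_image_sub_le_of_norm_hasFDerivWithin_le'
    (f := V) (φ := InnerProductSpace.toDual ℝ (Euc d) g) (C := ν / 8 * ‖z - x‖)
    (fun w _ => (hder w).hasFDerivWithinAt) (by
      intro w hw
      rw [← map_sub, LinearIsometryEquiv.norm_map]
      refine (hlip w (hseg hw) x hxr).trans ?_
      gcongr
      have := norm_sub_le_of_mem_segment hw
      simpa [norm_sub_rev] using this)
    (left_mem_segment ℝ x z) (right_mem_segment ℝ x z)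
  have hin : (InnerProductSpace.toDual ℝ (Euc d) g) (z - x) = -(4 / ν * ‖g‖ ^ 2) := by
    have : z - x = -((4 / ν) • g) := by rw [hz]; abel
    rw [this, InnerProductSpace.toDual_apply_apply, inner_neg_right, real_inner_smul_right,
      real_inner_self_eq_norm_sq]
  rw [hin, hzx] at hmv
  have h1 := (abs_le.1 hmv).2
  have e : ν / 8 * (4 / ν * ‖g‖) * (4 / ν * ‖g‖) = 2 * (‖g‖ ^ 2 / ν) := by
    field_simp; ring
  have e2 : 4 / ν * ‖g‖ ^ 2 = 4 * (‖g‖ ^ 2 / ν) := by ring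
  rw [e, e2] at h1
  have hzmin : V y ≤ V z := (hball hzr).2.1
  have hxmin : V y ≤ V x := (hball hxr).2.1
  have hp : V x - V y ≤ ‖g‖ ^ 2 / ν := by
    rw [le_div_iff₀ hν, mul_comm]; exact (hball hxr).2.2
  linarith

theorem aux_hess_flat {d : ℕ} {V : Euc d → ℝ} {y : Euc d} (h : ∀ᶠ x in 𝓝 y, V x = V y) :
    ∀ᶠ x in 𝓝 y, gradient V x = 0 ∧ fderiv ℝ (gradient V) x = 0 := by
  have h1 : ∀ᶠ x in 𝓝 y, gradient V x = 0 := by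
    filter_upwards [h.eventually_nhds] with x hx
    have : V =ᶠ[𝓝 x] fun _ => V y := hx
    simp [gradient, this.fderiv_eq]
  filter_upwards [h1.eventually_nhds] with x hx
  have : gradient V =ᶠ[𝓝 x] fun _ => 0 := hx
  exact ⟨hx.self_of_nhds, by simp [this.fderiv_eq]⟩

theorem aux_isolated {d : ℕ} {V : Euc d → ℝ} (hV : ContDiff ℝ 2 V) {x : Euc d}
    (hH : ∀ v : Euc d, v ≠ 0 → hessQ V x v < 0) :
    ∀ᶠ y in 𝓝[≠] x, gradient V y ≠ 0 := by
  have hd : HasFDerivAt (gradient V) (fderiv ℝ (gradient V) x) x :=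
    (((aux_grad hV).differentiable (by norm_num)) x).hasFDerivAt
  have hinj : (fderiv ℝ (gradient V) x).ker = ⊥ := by
    rw [LinearMap.ker_eq_bot']
    intro v hv
    by_contra hne
    have := hH v hne
    have hv' : fderiv ℝ (gradient V) x v = 0 := hv
    simp [hessQ, hv'] at this
  obtain ⟨K, hK, hK2⟩ := (fderiv ℝ (gradient V) x).toLinearMap.exists_antilipschitzWith hinj
  exact hd.eventually_ne ⟨K, hK2⟩

theorem aux_strict {d : ℕ} {V : Euc d → ℝ} {x : Euc d} (hx : IsLocalMax V x)
    (h : ∀ᶠ y in 𝓝[≠] x, gradient V y ≠ 0) : ∀ᶠ y in 𝓝[≠] x, V y < V x := by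
  have hx2 : ∀ᶠ y in 𝓝 x, ∀ᶠ z in 𝓝 y, V z ≤ V x := Filter.Eventually.eventually_nhds hx
  filter_upwards [h, hx2.filter_mono nhdsWithin_le_nhds] with y hy hy2
  refine lt_of_le_of_ne hy2.self_of_nhds fun heq => hy (aux_crit (Or.inr ?_))
  rw [← heq] at hy2
  exact hy2

theorem aux_min {d : ℕ} {V : Euc d → ℝ} {ν : ℝ} {𝒩 : Set (Euc d) → Set (Euc d)}
    (h1 : Assumption1 V ν 𝒩) (hb : BddBelow (range V)) {x : Euc d} (hx : x ∈ NSet V 𝒩)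
    (hg : gradient V x = 0) :
    (∀ᶠ y in 𝓝 x, V x ≤ V y) ∧ ∀ᶠ y in 𝓝 x, ν * (V y - V x) ≤ ‖gradient V y‖ ^ 2 := by
  obtain ⟨hν, h1⟩ := h1
  simp only [NSet, mem_iUnion, exists_prop] at hx
  obtain ⟨m, hm, hxm⟩ := hx
  obtain ⟨ho, -, -, hPL⟩ := h1 m hm
  set N := 𝒩 (connectedComponentIn (localMinSet V) m)
  have hb' : BddBelow (V '' N) := hb.mono (image_subset_range _ _)
  have hle : V x ≤ sInf (V '' N) := by
    have := hPL x hxm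
    rw [hg] at this
    by_contra hc
    push Not at hc
    have := mul_pos hν (sub_pos.2 hc)
    simp at *
    linarith
  have heq : sInf (V '' N) = V x := le_antisymm (csInf_le hb' (mem_image_of_mem _ hxm)) hle
  constructor
  · filter_upwards [ho.mem_nhds hxm] with y hy
    exact hle.trans (csInf_le hb' (mem_image_of_mem _ hy))
  · filter_upwards [ho.mem_nhds hxm] with y hy
    rw [← heq]; exact hPL y hy

/-- the set of local maxima is finite, and every local maximum is a
strict local maximum with negative definite Hessian. -/
theorem localMaxSet_finite
    {d : ℕ} (V : Euc d → ℝ) (hV : ContDiff ℝ 2 V)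
    (ν : ℝ) (𝒩 : Set (Euc d) → Set (Euc d))
    (h1 : Assumption1 V ν 𝒩) (h2 : Assumption2 V 𝒩)
    (R₀ ν_eb C_g : ℝ) (h3 : Assumption3 V R₀ ν_eb C_g) :
    (localMaxSet V).Finite ∧
      ∀ x ∈ localMaxSet V,
        (∀ᶠ y in 𝓝[≠] x, V y < V x) ∧ ∀ v : Euc d, v ≠ 0 → hessQ V x v < 0 := by
  rcases Nat.eq_zero_or_pos d with hd | hd
  · subst hd
    have hsub : Subsingleton (Euc 0) := inferInstance
    refine ⟨Set.toFinite _, fun x _ => ⟨?_, fun v hv => absurd (Subsingleton.elim v 0) hv⟩⟩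
    have : 𝓝[≠] x = ⊥ := by
      rw [show ({x}ᶜ : Set (Euc 0)) = ∅ from by
        ext y; simp [Subsingleton.elim y x]]
      simp
    simp [this]
  have : Nonempty (Fin d) := ⟨⟨0, hd⟩⟩
  have : Nontrivial (Euc d) := inferInstance
  obtain ⟨hR, hνe, hCg, hgrow, hco, hSR⟩ := h3
  obtain ⟨x₀, hx₀⟩ := hV.continuous.exists_forall_le hco
  have hb : BddBelow (range V) := ⟨V x₀, by rintro _ ⟨y, rfl⟩; exact hx₀ y⟩
  have hne : (localMinSet V).Nonempty := ⟨x₀, Eventually.of_forall hx₀⟩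
  have hgc : Continuous (gradient V) := (aux_grad hV).continuous
  have hhc : Continuous (fderiv ℝ (gradient V)) := (aux_grad hV).continuous_fderiv (by norm_num)
  -- the flat set is empty
  have hflat : {y | gradient V y = 0 ∧ fderiv ℝ (gradient V) y = 0} = ∅ := by
    have hcl : IsClosed {y | gradient V y = 0 ∧ fderiv ℝ (gradient V) y = 0} :=
      (isClosed_eq hgc continuous_const).inter (isClosed_eq hhc continuous_const)
    have hop : IsOpen {y | gradient V y = 0 ∧ fderiv ℝ (gradient V) y = 0} := by
      rw [isOpen_iff_mem_nhds]
      rintro y ⟨hy1, hy2⟩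
      have hyN : y ∈ NSet V 𝒩 := by
        by_contra hc
        obtain ⟨v, hv⟩ := exists_ne (0 : Euc d)
        have := h2 y hc hy1 v hv
        simp [hessQ, hy2] at this
      obtain ⟨ha, hb⟩ := aux_min h1 hb hyN hy1
      exact aux_hess_flat (aux_flat hV h1.1 hy2 hy1 ha hb)
    rcases isClopen_iff.1 ⟨hcl, hop⟩ with h | h
    · exact h
    · exfalso
      have hconst : ∀ x, V x = V 0 := fun x => by
        refine is_const_of_fderiv_eq_zero (𝕜 := ℝ) (hV.differentiable (by norm_num)) (fun y => ?_) x 0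
        have : y ∈ {y | gradient V y = 0 ∧ fderiv ℝ (gradient V) y = 0} := h ▸ mem_univ y
        have := this.1
        simpa [gradient] using this
      have : NeBot (cocompact (Euc d)) := inferInstance
      obtain ⟨x, hx⟩ := (hco.eventually_gt_atTop (V 0)).exists
      exact absurd (hconst x) hx.ne'
  have hout : ∀ x ∈ localMaxSet V, x ∉ NSet V 𝒩 := by
    intro x hx hxN
    have hx' : IsLocalMax V x := hx
    obtain ⟨ha, -⟩ := aux_min h1 hb hxN (aux_crit (Or.inr hx'))
    have hc : ∀ᶠ y in 𝓝 x, V y = V x := by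
      filter_upwards [ha, hx'] with y h h' using le_antisymm h' h
    have : x ∈ {y | gradient V y = 0 ∧ fderiv ℝ (gradient V) y = 0} :=
      (aux_hess_flat hc).self_of_nhds
    rw [hflat] at this
    exact this
  have hneg : ∀ x ∈ localMaxSet V, ∀ v : Euc d, v ≠ 0 → hessQ V x v < 0 := fun x hx =>
    h2 x (hout x hx) (aux_crit (Or.inr hx))
  refine ⟨?_, fun x hx => ⟨aux_strict hx (aux_isolated hV (hneg x hx)), hneg x hx⟩⟩
  have hNo : IsOpen (NSet V 𝒩) := isOpen_biUnion fun x hx => (h1.2 x hx).1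
  have hKc : IsClosed {x | gradient V x = 0 ∧ x ∉ NSet V 𝒩} :=
    (isClosed_eq hgc continuous_const).inter hNo.isClosed_compl
  have hKb : {x | gradient V x = 0 ∧ x ∉ NSet V 𝒩} ⊆ closedBall 0 R₀ := by
    rintro x ⟨hx, -⟩
    by_contra hc
    have hlt : R₀ < ‖x‖ := by simpa using hc
    have h := (hgrow x hlt.le).1
    rw [hx, norm_zero] at h
    have h0 : infDist x (localMinSet V) = 0 :=
      le_antisymm (by by_contra hh; push Not at hh; linarith [mul_pos hνe hh]) infDist_nonneg
    have : x ∈ closure (localMinSet V) := (mem_closure_iff_infDist_zero hne).2 h0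
    exact hc (closure_minimal hSR isClosed_closedBall this)
  have hK : IsCompact {x | gradient V x = 0 ∧ x ∉ NSet V 𝒩} :=
    (isCompact_closedBall (0 : Euc d) R₀).of_isClosed_subset hKc hKb
  refine Set.Finite.subset (s := {x | gradient V x = 0 ∧ x ∉ NSet V 𝒩}) ?_
    (fun x hx => ⟨aux_crit (Or.inr hx), hout x hx⟩)
  by_contra hinf
  obtain ⟨x, hxK, hacc⟩ := Set.Infinite.exists_accPt_of_subset_isCompact hinf hK subset_rfl
  have hiso := aux_isolated hV (h2 x hxK.2 hxK.1)
  rw [accPt_iff_frequently_nhdsNE] at hacc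
  obtain ⟨y, hy, hy'⟩ := (hacc.and_eventually hiso).exists
  exact hy' hy.1
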